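/- arXiv:1811.02912 — 4 statements merged into one kernel-verified Lean document; each statement's English description precedes it below -/
import Mathlib

section
/- Let ρ₀, ρ, k, v, ω be positive real numbers with 0 < ρ < ρ₀, and let Â < 0 be a real number. Then ω_M² := 8πk/((ρ−ρ₀)Â) is positive; let ω_M := (ω_M²)^{1/2} > 0 and assume ω ≠ ω_M. Then the scattering coefficient C := κ² v / ( ρ/(ρ−ρ₀) − κ²Â/(8π) ), where κ² := ω²ρ/k, satisfies: C > 0 if and only if ω > ω_M, and C < 0 if and only if ω < ω_M. -/
/-- For positive `ρ₀, ρ, k, v, ω` with `0 < ρ < ρ₀` and negative `Â` (= `Ahat`), the squared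
Minnaert frequency `ω_M² := 8πk/((ρ−ρ₀)Â)` is positive, and if `ω ≠ ω_M := √(ω_M²)` then the
scattering coefficient `C := κ²v/(ρ/(ρ−ρ₀) − κ²Â/(8π))`, with `κ² := ω²ρ/k`, satisfies
`C > 0 ↔ ω > ω_M` and `C < 0 ↔ ω < ω_M`. -/
theorem scattering_coefficient_sign_characterization
    (ρ₀ ρ k v ω Ahat : ℝ)
    (hρ₀ : 0 < ρ₀) (hρ : 0 < ρ) (hρρ₀ : ρ < ρ₀) (hk : 0 < k) (hv : 0 < v) (hω : 0 < ω)
    (hA : Ahat < 0)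
    (hωne : ω ≠ Real.sqrt (8 * Real.pi * k / ((ρ - ρ₀) * Ahat))) :
    0 < 8 * Real.pi * k / ((ρ - ρ₀) * Ahat) ∧
    (0 < (ω ^ 2 * ρ / k) * v / (ρ / (ρ - ρ₀) - (ω ^ 2 * ρ / k) * Ahat / (8 * Real.pi)) ↔
      Real.sqrt (8 * Real.pi * k / ((ρ - ρ₀) * Ahat)) < ω) ∧
    ((ω ^ 2 * ρ / k) * v / (ρ / (ρ - ρ₀) - (ω ^ 2 * ρ / k) * Ahat / (8 * Real.pi)) < 0 ↔
      ω < Real.sqrt (8 * Real.pi * k / ((ρ - ρ₀) * Ahat))) := by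
  have hρ_sub : ρ - ρ₀ < 0 := sub_neg.mpr hρρ₀
  have hM : 0 < 8 * Real.pi * k / ((ρ - ρ₀) * Ahat) :=
    div_pos (by positivity) (mul_pos_of_neg_of_neg hρ_sub hA)
  have hdenom : ρ / (ρ - ρ₀) - (ω ^ 2 * ρ / k) * Ahat / (8 * Real.pi) =
      ρ * -Ahat / (8 * Real.pi * k) * (ω ^ 2 - 8 * Real.pi * k / ((ρ - ρ₀) * Ahat)) := by
    have hρ_ne : ρ - ρ₀ ≠ 0 := hρ_sub.ne
    have hA_ne : Ahat ≠ 0 := hA.ne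
    field_simp
    ring
  have hnum : 0 < ω ^ 2 * ρ / k * v := by positivity
  have hfactor : 0 < ρ * -Ahat / (8 * Real.pi * k) :=
    div_pos (mul_pos hρ (neg_pos.mpr hA)) (by positivity)
  refine ⟨hM, ?_, ?_⟩
  · rw [hdenom, div_pos_iff_of_pos_left hnum, mul_pos_iff_of_pos_left hfactor, sub_pos,
      Real.sqrt_lt' hω]
  · rw [hdenom, div_neg_iff, or_iff_left (fun h => hnum.not_gt h.1), and_iff_right hnum,
      mul_neg_iff, or_iff_left (fun h => hfactor.not_gt h.1), and_iff_right hfactor, sub_neg,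
      Real.lt_sqrt hω.le]
end

section
/- Bubble scaling setup with γ = 1: given positive reals ω-independent data ρ₀, k̄, C_ρ, b and a real Ā < 0, for a ∈ (0,1) set ρ(a) := C_ρ ρ₀ a², k(a) := k̄ a², v(a) := b a³, Â(a) := Ā a², ω_M(a)² := 8π k(a)/((ρ(a)−ρ₀) Â(a)), and ω̄_M² := −8π k̄/(ρ₀ Ā) > 0. Fix h₁ ∈ (0,1) and a real l_M ≠ 0. If for some a ∈ (0, C_ρ^{−1/2}) ∩ (0,1) a frequency ω_a > 0 satisfies 1 − ω_M(a)²/ω_a² = l_M a^{h₁}, then the scattering coefficient computed at frequency ω_a, namely C(a) := κ_a² v(a) / ( ρ(a)/(ρ(a)−ρ₀) − κ_a² Â(a)/(8π) ) with κ_a² := ω_a² ρ(a)/k(a), is given exactly by C(a) = ( ω̄_M² ρ₀ b / (l_M k̄) ) · a^{1−h₁}. -/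
/-- Bubble scaling with `γ = 1`: with `ρ(a) = C_ρ ρ₀ a²`, `k(a) = k̄ a²`, `v(a) = b a³`,
`Â(a) = Ā a²`, `ω_M(a)² = 8πk(a)/((ρ(a)−ρ₀)Â(a))` and `ω̄_M² = −8πk̄/(ρ₀Ā) > 0`, if a frequency
`ω_a > 0` satisfies `1 − ω_M(a)²/ω_a² = l_M a^{h₁}` (with `h₁ ∈ (0,1)`, `l_M ≠ 0`,
`a ∈ (0, C_ρ^{−1/2}) ∩ (0,1)`), then the scattering coefficient at frequency `ω_a` equals
`(ω̄_M² ρ₀ b/(l_M k̄)) · a^{1−h₁}` exactly. -/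
theorem scattering_coefficient_near_resonance_scaling
    (ρ₀ kbar Cρ b Abar h₁ lM a ωa : ℝ)
    (hρ₀ : 0 < ρ₀) (hk : 0 < kbar) (hCρ : 0 < Cρ) (hb : 0 < b) (hA : Abar < 0)
    (hh₁ : h₁ ∈ Set.Ioo (0 : ℝ) 1) (hlM : lM ≠ 0)
    (ha : a ∈ Set.Ioo (0 : ℝ) 1) (haC : a < Cρ⁻¹ ^ ((1 : ℝ) / 2))
    (hωa : 0 < ωa)
    (hfreq : 1 - (8 * Real.pi * (kbar * a ^ 2) /
        ((Cρ * ρ₀ * a ^ 2 - ρ₀) * (Abar * a ^ 2))) / ωa ^ 2 = lM * a ^ h₁) :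
    0 < -8 * Real.pi * kbar / (ρ₀ * Abar) ∧
    (ωa ^ 2 * (Cρ * ρ₀ * a ^ 2) / (kbar * a ^ 2)) * (b * a ^ 3) /
        ((Cρ * ρ₀ * a ^ 2) / (Cρ * ρ₀ * a ^ 2 - ρ₀)
          - (ωa ^ 2 * (Cρ * ρ₀ * a ^ 2) / (kbar * a ^ 2)) * (Abar * a ^ 2) / (8 * Real.pi))
      = ((-8 * Real.pi * kbar / (ρ₀ * Abar)) * ρ₀ * b / (lM * kbar)) * a ^ (1 - h₁) := by
  obtain ⟨ha0, -⟩ := ha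
  have hπ : 0 < Real.pi := Real.pi_pos
  have ha2 : a ^ 2 < Cρ⁻¹ := by
    rw [← Real.sqrt_eq_rpow] at haC
    exact (Real.lt_sqrt ha0.le).1 haC
  have hcontrast : Cρ * a ^ 2 < 1 := by
    have := mul_lt_mul_of_pos_left ha2 hCρ
    rwa [mul_inv_cancel₀ hCρ.ne'] at this
  have hden : Cρ * ρ₀ * a ^ 2 - ρ₀ ≠ 0 := by
    have : Cρ * ρ₀ * a ^ 2 - ρ₀ < 0 := by nlinarith
    exact this.ne
  have hah : a ^ h₁ ≠ 0 := (Real.rpow_pos_of_pos ha0 h₁).ne'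
  have hdenominator : (Cρ * ρ₀ * a ^ 2) / (Cρ * ρ₀ * a ^ 2 - ρ₀)
      - (ωa ^ 2 * (Cρ * ρ₀ * a ^ 2) / (kbar * a ^ 2)) * (Abar * a ^ 2) / (8 * Real.pi)
      = -(Cρ * ρ₀ * a ^ 2 * Abar * ωa ^ 2 / (8 * Real.pi * kbar)) * (lM * a ^ h₁) := by
    rw [← hfreq]
    generalize Cρ * ρ₀ * a ^ 2 - ρ₀ = d at hden
    have hA' := hA.ne
    field_simp
    ring
  refine ⟨div_pos_of_neg_of_neg (by nlinarith [mul_pos hπ hk]) (mul_neg_of_pos_of_neg hρ₀ hA), ?_⟩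
  rw [hdenominator, Real.rpow_sub ha0, Real.rpow_one]
  have hA' := hA.ne
  field_simp
end

section
/- Bubble scaling setup with γ ∈ (0,1): given positive reals ω, ρ₀, k̄, C_ρ, b and a real Ā < 0, for a ∈ (0,1) set ρ(a) := C_ρ ρ₀ a^{1+γ}, k(a) := k̄ a^{1+γ}, κ² := ω² C_ρ ρ₀ / k̄ (so κ² = ω²ρ(a)/k(a)), v(a) := b a³, Â(a) := Ā a², and C(a) := κ² v(a) / ( ρ(a)/(ρ(a)−ρ₀) − κ² Â(a)/(8π) ). Then there exist constants M > 0 and a₀ ∈ (0,1) such that for all a ∈ (0,a₀) the denominator ρ(a)/(ρ(a)−ρ₀) − κ²Â(a)/(8π) is nonzero and | a^{γ−2} C(a) + ω² ρ₀ b / k̄ | ≤ M a^{1−γ}. -/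
/-- The leading-order error of `K b p / (c p / (c p - 1) + α p q)` is controlled by `q`
when `0 < p ≤ q` and `q` is small. -/
lemma abs_div_resonant_denominator_add_le {c α K p q : ℝ} (hc : 0 < c) (hα : 0 < α) (hK : 0 < K)
    (hp : 0 < p) (hpq : p ≤ q) (hcq : c * q < 1) (hαq : α * q < c / 2) :
    c * p / (c * p - 1) + α * (p * q) ≠ 0 ∧
      |K * p / (c * p / (c * p - 1) + α * (p * q)) + K / c| ≤
        2 * K * (c ^ 2 + α) / c ^ 2 * q := by
  have hq : 0 < q := hp.trans_le hpq
  have hcp : c * p < 1 := (mul_le_mul_of_nonneg_left hpq hc.le).trans_lt hcq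
  have hcp0 : 0 < c * p := mul_pos hc hp
  have hne : c * p - 1 ≠ 0 := by linarith
  have hαq0 : 0 < α * q := mul_pos hα hq
  have hE : c / 2 < c + α * q * (c * p - 1) := by nlinarith [mul_pos hαq0 hcp0]
  have hE0 : 0 < c + α * q * (c * p - 1) := by linarith
  have hden : c * p / (c * p - 1) + α * (p * q)
      = p * (c + α * q * (c * p - 1)) / (c * p - 1) := by
    field_simp
  have hden0 : c * p / (c * p - 1) + α * (p * q) ≠ 0 := by
    rw [hden]
    exact div_ne_zero (mul_pos hp hE0).ne' hne
  refine ⟨hden0, ?_⟩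
  have hsum : K * p / (c * p / (c * p - 1) + α * (p * q)) + K / c
      = K * (c ^ 2 * p + α * q * (c * p - 1)) / (c * (c + α * q * (c * p - 1))) := by
    rw [hden]
    generalize hEdef : c + α * q * (c * p - 1) = E at *
    field_simp
    linear_combination (-1 : ℝ) * hEdef
  have hnum : |c ^ 2 * p + α * q * (c * p - 1)| ≤ (c ^ 2 + α) * q := by
    have hc2 : c ^ 2 * p ≤ c ^ 2 * q := mul_le_mul_of_nonneg_left hpq (sq_nonneg c)
    have hc2p : 0 < c ^ 2 * p := by positivity
    rw [abs_le]
    constructor <;> nlinarith [mul_pos hαq0 hcp0, mul_pos (pow_pos hc 2) hq]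
  rw [hsum, abs_div, abs_mul, abs_of_pos hK, abs_of_pos (mul_pos hc hE0)]
  calc K * |c ^ 2 * p + α * q * (c * p - 1)| / (c * (c + α * q * (c * p - 1)))
      ≤ K * ((c ^ 2 + α) * q) / (c * (c / 2)) := by gcongr
    _ = 2 * K * (c ^ 2 + α) / c ^ 2 * q := by field_simp

/-- Bubble scaling with `γ ∈ (0,1)`: with `ρ(a) = C_ρ ρ₀ a^{1+γ}`, `k(a) = k̄ a^{1+γ}`,
`κ² = ω²C_ρρ₀/k̄`, `v(a) = b a³`, `Â(a) = Ā a²` and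
`C(a) = κ²v(a)/(ρ(a)/(ρ(a)−ρ₀) − κ²Â(a)/(8π))`, there are `M > 0` and `a₀ ∈ (0,1)` such that
for all `a ∈ (0,a₀)` the denominator is nonzero and
`|a^{γ−2}C(a) + ω²ρ₀b/k̄| ≤ M a^{1−γ}`. -/
theorem scattering_coefficient_expansion_gamma_lt_one
    (ω ρ₀ kbar Cρ b Abar γ : ℝ)
    (hω : 0 < ω) (hρ₀ : 0 < ρ₀) (hk : 0 < kbar) (hCρ : 0 < Cρ) (hb : 0 < b)
    (hA : Abar < 0) (hγ0 : 0 < γ) (hγ1 : γ < 1) :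
    ∃ M > 0, ∃ a₀ ∈ Set.Ioo (0 : ℝ) 1, ∀ a ∈ Set.Ioo (0 : ℝ) a₀,
      (Cρ * ρ₀ * a ^ (1 + γ)) / (Cρ * ρ₀ * a ^ (1 + γ) - ρ₀)
        - (ω ^ 2 * Cρ * ρ₀ / kbar) * (Abar * a ^ 2) / (8 * Real.pi) ≠ 0 ∧
      |a ^ (γ - 2) * ((ω ^ 2 * Cρ * ρ₀ / kbar) * (b * a ^ 3) /
            ((Cρ * ρ₀ * a ^ (1 + γ)) / (Cρ * ρ₀ * a ^ (1 + γ) - ρ₀)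
              - (ω ^ 2 * Cρ * ρ₀ / kbar) * (Abar * a ^ 2) / (8 * Real.pi)))
          + ω ^ 2 * ρ₀ * b / kbar| ≤ M * a ^ (1 - γ) := by
  set κ := ω ^ 2 * Cρ * ρ₀ / kbar with hκ
  have hκ0 : 0 < κ := by positivity
  set α := -(κ * Abar) / (8 * Real.pi) with hαdef
  have hα : 0 < α := by
    have : κ * Abar < 0 := mul_neg_of_pos_of_neg hκ0 hA
    exact div_pos (by linarith) (by positivity)
  have hγ : 0 < 1 - γ := by linarith
  set ε := min (1 / Cρ) (Cρ / 2 / α) with hε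
  have hε0 : 0 < ε := lt_min (by positivity) (by positivity)
  refine ⟨2 * (κ * b) * (Cρ ^ 2 + α) / Cρ ^ 2, by positivity, min (1 / 2) (ε ^ (1 - γ)⁻¹),
    ⟨lt_min (by norm_num) (Real.rpow_pos_of_pos hε0 _),
      (min_le_left _ _).trans_lt (by norm_num)⟩, ?_⟩
  rintro a ⟨ha, ha₀⟩
  have ha1 : a < 1 := (ha₀.trans_le (min_le_left _ _)).trans (by norm_num)
  have hqε : a ^ (1 - γ) < ε :=
    (Real.lt_rpow_inv_iff_of_pos ha.le hε0.le hγ).1 (ha₀.trans_le (min_le_right _ _))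
  have hcq : Cρ * a ^ (1 - γ) < 1 := (lt_div_iff₀' hCρ).1 (hqε.trans_le (min_le_left _ _))
  have hαq : α * a ^ (1 - γ) < Cρ / 2 := (lt_div_iff₀' hα).1 (hqε.trans_le (min_le_right _ _))
  have hpq : a ^ (1 + γ) ≤ a ^ (1 - γ) :=
    Real.rpow_le_rpow_of_exponent_ge ha ha1.le (by linarith)
  have ha2 : a ^ 2 = a ^ (1 + γ) * a ^ (1 - γ) := by
    rw [← Real.rpow_add ha, ← Real.rpow_natCast]
    norm_num
  have ha3 : a ^ (γ - 2) * a ^ 3 = a ^ (1 + γ) := by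
    rw [← Real.rpow_natCast, ← Real.rpow_add ha]
    congr 1
    push_cast
    ring
  obtain ⟨h0, hle⟩ := abs_div_resonant_denominator_add_le hCρ hα (mul_pos hκ0 hb)
    (Real.rpow_pos_of_pos ha _) hpq hcq hαq
  have hden : Cρ * ρ₀ * a ^ (1 + γ) / (Cρ * ρ₀ * a ^ (1 + γ) - ρ₀)
        - κ * (Abar * a ^ 2) / (8 * Real.pi)
      = Cρ * a ^ (1 + γ) / (Cρ * a ^ (1 + γ) - 1) + α * (a ^ (1 + γ) * a ^ (1 - γ)) := by
    have hρ : Cρ * ρ₀ * a ^ (1 + γ) / (Cρ * ρ₀ * a ^ (1 + γ) - ρ₀)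
        = Cρ * a ^ (1 + γ) / (Cρ * a ^ (1 + γ) - 1) := by
      rw [← mul_div_mul_left (Cρ * a ^ (1 + γ)) _ hρ₀.ne']
      congr 1 <;> ring
    rw [hρ, ← ha2, hαdef]
    ring
  have hlead : ω ^ 2 * ρ₀ * b / kbar = κ * b / Cρ := by
    rw [hκ]
    field_simp
  rw [hden, hlead, ← mul_div_assoc,
    show a ^ (γ - 2) * (κ * (b * a ^ 3)) = κ * b * a ^ (1 + γ) by rw [← ha3]; ring]
  exact ⟨h0, hle⟩
end

section
/- Let K ⊆ ℝ³ be a nonempty compact set and suppose there are constants C₀ > 0 and δ₀ > 0 such that vol({x ∈ ℝ³ : dist(x,K) ≤ δ}) ≤ C₀·δ for all δ ∈ (0,δ₀]. Let ℓ > 0 satisfy ℓ·√3 ≤ δ₀, and let (Q_i)_{i∈I} be a family of axis-parallel closed cubes of side length ℓ with pairwise disjoint interiors, each of which intersects K. Then I is finite with card(I) ≤ √3·C₀·ℓ^{−2}, and the total volume of the cubes satisfies Σ_{i∈I} vol(Q_i) ≤ √3·C₀·ℓ. -/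
open MeasureTheory

/-- A closed axis-parallel cube in Euclidean space has the product volume. -/
lemma EuclideanSpace.volume_setOf_forall_mem_Icc {ι : Type*} [Fintype ι]
    (c : EuclideanSpace ℝ ι) (ℓ : ℝ) :
    volume {x : EuclideanSpace ℝ ι | ∀ j, x j ∈ Set.Icc (c j) (c j + ℓ)} =
      ENNReal.ofReal ℓ ^ Fintype.card ι := by
  have h : {x : EuclideanSpace ℝ ι | ∀ j, x j ∈ Set.Icc (c j) (c j + ℓ)} =
      WithLp.ofLp ⁻¹' Set.univ.pi fun j => Set.Icc (c j) (c j + ℓ) := by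
    ext x; simp only [Set.mem_ofPred_eq, Set.mem_preimage, Set.mem_univ_pi]
  rw [h, (PiLp.volume_preserving_ofLp ι).measure_preimage
    (MeasurableSet.univ_pi fun _ => measurableSet_Icc).nullMeasurableSet, volume_pi_pi]
  simp

/-- An open axis-parallel cube in Euclidean space has the product volume. -/
lemma EuclideanSpace.volume_setOf_forall_mem_Ioo {ι : Type*} [Fintype ι]
    (c : EuclideanSpace ℝ ι) (ℓ : ℝ) :
    volume {x : EuclideanSpace ℝ ι | ∀ j, x j ∈ Set.Ioo (c j) (c j + ℓ)} =
      ENNReal.ofReal ℓ ^ Fintype.card ι := by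
  have h : {x : EuclideanSpace ℝ ι | ∀ j, x j ∈ Set.Ioo (c j) (c j + ℓ)} =
      WithLp.ofLp ⁻¹' Set.univ.pi fun j => Set.Ioo (c j) (c j + ℓ) := by
    ext x; simp only [Set.mem_ofPred_eq, Set.mem_preimage, Set.mem_univ_pi]
  rw [h, (PiLp.volume_preserving_ofLp ι).measure_preimage
    (MeasurableSet.univ_pi fun _ => measurableSet_Ioo).nullMeasurableSet, volume_pi_pi]
  simp

/-- The interior of a closed axis-parallel cube contains the open cube. -/
lemma EuclideanSpace.setOf_forall_mem_Ioo_subset_interior {ι : Type*} [Fintype ι]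
    (c : EuclideanSpace ℝ ι) (ℓ : ℝ) :
    {x : EuclideanSpace ℝ ι | ∀ j, x j ∈ Set.Ioo (c j) (c j + ℓ)} ⊆
      interior {x : EuclideanSpace ℝ ι | ∀ j, x j ∈ Set.Icc (c j) (c j + ℓ)} := by
  refine interior_maximal (fun x hx j => Set.Ioo_subset_Icc_self (hx j)) ?_
  simp only [Set.ofPred_forall]
  exact isOpen_iInter_of_finite fun j => isOpen_Ioo.preimage (by fun_prop)

/-- Two points of an axis-parallel cube of side `ℓ` are at distance at most `ℓ * √d`. -/
lemma EuclideanSpace.dist_le_of_forall_mem_Icc {ι : Type*} [Fintype ι]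
    {c x y : EuclideanSpace ℝ ι} {ℓ : ℝ} (hℓ : 0 ≤ ℓ)
    (hx : ∀ j, x j ∈ Set.Icc (c j) (c j + ℓ)) (hy : ∀ j, y j ∈ Set.Icc (c j) (c j + ℓ)) :
    dist x y ≤ ℓ * Real.sqrt (Fintype.card ι) := by
  rw [EuclideanSpace.dist_eq]
  refine Real.sqrt_le_iff.mpr ⟨by positivity, ?_⟩
  rw [mul_pow, Real.sq_sqrt (Nat.cast_nonneg _)]
  calc ∑ j, dist (x j) (y j) ^ 2 ≤ ∑ _j : ι, ℓ ^ 2 := by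
        gcongr with j
        have h := Real.dist_le_of_mem_Icc (hx j) (hy j)
        linarith
    _ = ℓ ^ 2 * Fintype.card ι := by simp [mul_comm]


open MeasureTheory

/-- Cube-counting near a compact set in `ℝ³` with a one-sided upper Minkowski content bound:
if `vol({dist(·,K) ≤ δ}) ≤ C₀δ` for `δ ∈ (0,δ₀]`, `ℓ√3 ≤ δ₀`, and `(Q_i)` is a family of
axis-parallel closed cubes of side `ℓ` with pairwise disjoint interiors, each meeting `K`, then
the family is finite, has at most `√3·C₀·ℓ⁻²` members, and its total volume is at most
`√3·C₀·ℓ`. -/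
theorem cube_counting_near_compact_set_3d
    (K : Set (EuclideanSpace ℝ (Fin 3))) (hK : IsCompact K) (hKne : K.Nonempty)
    (C₀ δ₀ : ℝ) (hC₀ : 0 < C₀) (hδ₀ : 0 < δ₀)
    (hmink : ∀ δ ∈ Set.Ioc (0 : ℝ) δ₀,
      volume (Metric.cthickening δ K) ≤ ENNReal.ofReal (C₀ * δ))
    (ℓ : ℝ) (hℓ : 0 < ℓ) (hℓδ : ℓ * Real.sqrt 3 ≤ δ₀)
    (I : Type) (Q : I → Set (EuclideanSpace ℝ (Fin 3)))
    (hQcube : ∀ i, ∃ c : EuclideanSpace ℝ (Fin 3),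
      Q i = {x | ∀ j, x j ∈ Set.Icc (c j) (c j + ℓ)})
    (hQdisj : Pairwise fun i j => Disjoint (interior (Q i)) (interior (Q j)))
    (hQK : ∀ i, (Q i ∩ K).Nonempty) :
    Finite I ∧ (Nat.card I : ℝ) ≤ Real.sqrt 3 * C₀ / ℓ ^ 2 ∧
    (∑' i, volume (Q i)) ≤ ENNReal.ofReal (Real.sqrt 3 * C₀ * ℓ) := by
  have hcover : ∀ i, Q i ⊆ Metric.cthickening (ℓ * Real.sqrt 3) K := by
    intro i x hx
    obtain ⟨y, hyQ, hyK⟩ := hQK i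
    obtain ⟨c, hc⟩ := hQcube i
    rw [hc] at hx hyQ
    refine Metric.mem_cthickening_of_dist_le x y _ K hyK ?_
    simpa using EuclideanSpace.dist_le_of_forall_mem_Icc hℓ.le hx hyQ
  have hvol : ∀ i, volume (Q i) = ENNReal.ofReal (ℓ ^ 3) := by
    intro i
    obtain ⟨c, hc⟩ := hQcube i
    rw [hc, EuclideanSpace.volume_setOf_forall_mem_Icc, ENNReal.ofReal_pow hℓ.le,
      Fintype.card_fin]
  have hint : ∀ i, volume (Q i) ≤ volume (interior (Q i)) := by
    intro i
    obtain ⟨c, hc⟩ := hQcube i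
    rw [hc, EuclideanSpace.volume_setOf_forall_mem_Icc,
      ← EuclideanSpace.volume_setOf_forall_mem_Ioo c]
    exact measure_mono (EuclideanSpace.setOf_forall_mem_Ioo_subset_interior c ℓ)
  have hsum : ∀ s : Finset I,
      ∑ i ∈ s, volume (Q i) ≤ ENNReal.ofReal (Real.sqrt 3 * C₀ * ℓ) := by
    intro s
    calc ∑ i ∈ s, volume (Q i) ≤ ∑ i ∈ s, volume (interior (Q i)) :=
          Finset.sum_le_sum fun i _ => hint i
      _ = volume (⋃ i ∈ s, interior (Q i)) :=
          (measure_biUnion_finset (fun i _ j _ hij => hQdisj hij)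
            fun i _ => isOpen_interior.measurableSet).symm
      _ ≤ volume (Metric.cthickening (ℓ * Real.sqrt 3) K) :=
          measure_mono (Set.iUnion₂_subset fun i _ => interior_subset.trans (hcover i))
      _ ≤ ENNReal.ofReal (C₀ * (ℓ * Real.sqrt 3)) := hmink _ ⟨by positivity, hℓδ⟩
      _ = ENNReal.ofReal (Real.sqrt 3 * C₀ * ℓ) := by ring_nf
  have hcard : ∀ s : Finset I, (s.card : ℝ) ≤ Real.sqrt 3 * C₀ / ℓ ^ 2 := by
    intro s
    have h := hsum s
    simp only [hvol, Finset.sum_const, nsmul_eq_mul] at h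
    rw [← ENNReal.ofReal_natCast, ← ENNReal.ofReal_mul (Nat.cast_nonneg _),
      ENNReal.ofReal_le_ofReal_iff (by positivity)] at h
    rw [le_div_iff₀ (by positivity)]
    refine le_of_mul_le_mul_right ?_ hℓ
    linarith
  have hfin : Finite I := by
    by_contra hI
    rw [not_finite_iff_infinite] at hI
    obtain ⟨n, hn⟩ := exists_nat_gt (Real.sqrt 3 * C₀ / ℓ ^ 2)
    obtain ⟨s, hs⟩ := Infinite.exists_subset_card_eq I n
    have h := hcard s
    rw [hs] at h
    linarith
  refine ⟨hfin, ?_, ?_⟩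
  · have := Fintype.ofFinite I
    simpa [Nat.card_eq_fintype_card] using hcard Finset.univ
  · rw [ENNReal.tsum_eq_iSup_sum]
    exact iSup_le hsum
end
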